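/- arXiv:cs/0111062 — 4 statements merged into one kernel-verified Lean document; each statement's English description precedes it below -/
import Mathlib

section
/- Let n ≥ 1 and 0 ≤ ε < 1/2, and let DISJ_n : {0,1}^n × {0,1}^n → {0,1} be the disjointness function, DISJ_n(x,y) = 1 if and only if there is no index i with x_i = y_i = 1, where Alice receives x and Bob receives y. Every quantum one-way protocol of cost m computing DISJ_n with error ε satisfies m ≥ (1 − H(ε))·n. -/
open scoped ComplexOrder

/-- `ρ` is a density matrix: positive semidefinite with trace 1. -/
def IsDensity {d : ℕ} (ρ : Matrix (Fin d) (Fin d) ℂ) : Prop :=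
  ρ.PosSemidef ∧ ρ.trace = 1

/-- `E` is a POVM element: `E` and `I − E` are positive semidefinite. -/
def IsPOVMElem {d : ℕ} (E : Matrix (Fin d) (Fin d) ℂ) : Prop :=
  E.PosSemidef ∧ (1 - E).PosSemidef

/-- Acceptance probability `tr(E·ρ)` (a real number). -/
noncomputable def accProb {d : ℕ} (E ρ : Matrix (Fin d) (Fin d) ℂ) : ℝ :=
  (E * ρ).trace.re

/-- The binary entropy function `H(ε) = −ε·log₂ ε − (1−ε)·log₂(1−ε)`
(with `H(0) = 0`, automatic since `Real.logb 2 0 = 0`). -/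
noncomputable def binEnt (e : ℝ) : ℝ :=
  -(e * Real.logb 2 e) - (1 - e) * Real.logb 2 (1 - e)

/-- `(ρ, E)` is a quantum one-way protocol of cost `m` computing `g` with error
`ε`: Alice sends the `m`-qubit state `ρ a`, Bob measures with the POVM element
`E b`, accepting with probability `tr(E b · ρ a)`. -/
def QOneWay {A B : Type} (g : A → B → Bool) (m : ℕ) (ε : ℝ)
    (ρ : A → Matrix (Fin (2 ^ m)) (Fin (2 ^ m)) ℂ)
    (E : B → Matrix (Fin (2 ^ m)) (Fin (2 ^ m)) ℂ) : Prop :=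
  (∀ a, IsDensity (ρ a)) ∧ (∀ b, IsPOVMElem (E b)) ∧
  ∀ a b, if g a b then 1 - ε ≤ accProb (E b) (ρ a) else accProb (E b) (ρ a) ≤ ε
/-- The disjointness function: `DISJ_n(x,y) = 1` iff there is no `i` with
`x_i = y_i = 1`. -/
def DISJ (n : ℕ) (x y : Fin n → Bool) : Bool :=
  decide (∀ i : Fin n, ¬(x i = true ∧ y i = true))

section CharacterSums

/-- The `±1`-valued sign of a bit. -/
def bitSign (b : Bool) : ℝ := if b then -1 else 1

lemma sum_bitSign_pow_nonneg (a : ℕ) : 0 ≤ ∑ b, bitSign b ^ a := by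
  rcases neg_one_pow_eq_or ℝ a with h | h <;> simp [bitSign, h]

lemma sum_prod_bool {ι : Type*} [Fintype ι] [DecidableEq ι] (f : ι → Bool → ℝ) :
    ∑ x : ι → Bool, ∏ i, f i (x i) = ∏ i, ∑ b, f i b := by
  rw [Finset.prod_univ_sum, Fintype.piFinset_univ]

lemma sum_prod_bitSign_pow_nonneg {ι : Type*} [Fintype ι] [DecidableEq ι] (a : ι → ℕ) :
    0 ≤ ∑ x : ι → Bool, ∏ i, bitSign (x i) ^ a i := by
  rw [sum_prod_bool fun i b => bitSign b ^ a i]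
  exact Finset.prod_nonneg fun i _ => sum_bitSign_pow_nonneg (a i)

lemma prod_bitSign_pow_mul_bitSign {ι : Type*} [Fintype ι] [DecidableEq ι] (a : ι → ℕ) (j : ι)
    (x : ι → Bool) : (∏ i, bitSign (x i) ^ a i) * bitSign (x j) =
      ∏ i, bitSign (x i) ^ (a i + if i = j then 1 else 0) := by
  simp_rw [pow_add, Finset.prod_mul_distrib]
  simp [pow_ite]

lemma sum_exp_sum_bitSign {ι : Type*} [Fintype ι] [DecidableEq ι] (t : ℝ) :
    ∑ x : ι → Bool, Real.exp (t * ∑ i, bitSign (x i)) =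
      (Real.exp t + Real.exp (-t)) ^ Fintype.card ι := by
  simp_rw [Finset.mul_sum, Real.exp_sum]
  rw [sum_prod_bool fun _ b => Real.exp (t * bitSign b)]
  simp [bitSign, add_comm]

/-- Moments of a signed sum of elements of norm at most one are dominated, even when twisted by a
character, by the corresponding scalar moments. -/
lemma norm_sum_character_smul_pow_le {ι R : Type*} [Fintype ι] [DecidableEq ι] [NormedRing R]
    [NormOneClass R] [NormedAlgebra ℂ R] (A : ι → R) (hA : ∀ i, ‖A i‖ ≤ 1) (k : ℕ) (a : ι → ℕ) :
    ‖∑ x : ι → Bool, ((∏ i, bitSign (x i) ^ a i : ℝ) : ℂ) • (∑ i, (bitSign (x i) : ℂ) • A i) ^ k‖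
      ≤ ∑ x : ι → Bool, (∏ i, bitSign (x i) ^ a i) * (∑ i, bitSign (x i)) ^ k := by
  induction k generalizing a with
  | zero =>
    simp only [pow_zero, mul_one]
    rw [← Finset.sum_smul, norm_smul, norm_one, mul_one, ← Complex.ofReal_sum, Complex.norm_real,
      Real.norm_of_nonneg (sum_prod_bitSign_pow_nonneg a)]
  | succ k ih =>
    have hL : ∑ x : ι → Bool, ((∏ i, bitSign (x i) ^ a i : ℝ) : ℂ) •
          (∑ i, (bitSign (x i) : ℂ) • A i) ^ (k + 1) =
        ∑ j, A j * ∑ x : ι → Bool, ((∏ i, bitSign (x i) ^ (a i + if i = j then 1 else 0) : ℝ) : ℂ) •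
          (∑ i, (bitSign (x i) : ℂ) • A i) ^ k := by
      simp_rw [Finset.mul_sum]
      rw [Finset.sum_comm]
      refine Finset.sum_congr rfl fun x _ => ?_
      rw [pow_succ', Finset.sum_mul, Finset.smul_sum]
      refine Finset.sum_congr rfl fun j _ => ?_
      rw [← prod_bitSign_pow_mul_bitSign, Complex.ofReal_mul, smul_mul_assoc, smul_smul,
        mul_smul_comm]
    have hR : ∑ x : ι → Bool, (∏ i, bitSign (x i) ^ a i) * (∑ i, bitSign (x i)) ^ (k + 1) =
        ∑ j, ∑ x : ι → Bool, (∏ i, bitSign (x i) ^ (a i + if i = j then 1 else 0)) *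
          (∑ i, bitSign (x i)) ^ k := by
      rw [Finset.sum_comm]
      refine Finset.sum_congr rfl fun x _ => ?_
      rw [pow_succ', Finset.sum_mul, Finset.mul_sum]
      refine Finset.sum_congr rfl fun j _ => ?_
      rw [← prod_bitSign_pow_mul_bitSign, mul_assoc]
    rw [hL, hR]
    refine norm_sum_le_of_le _ fun j _ => (norm_mul_le _ _).trans ?_
    exact (mul_le_of_le_one_left (norm_nonneg _) (hA j)).trans
      (ih fun i => a i + if i = j then 1 else 0)

end CharacterSums

section Matrices

open Matrix

open scoped Matrix.Norms.L2Operator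

variable {κ : Type*} [Fintype κ] [DecidableEq κ]

lemma norm_diag_le_l2_opNorm (M : Matrix κ κ ℂ) (i : κ) : ‖M i i‖ ≤ ‖M‖ := by
  have h := (PiLp.norm_apply_le _ i).trans (l2_opNorm_mulVec M (EuclideanSpace.single i (1 : ℂ)))
  simpa [PiLp.norm_single] using h

lemma re_trace_le_card_mul_l2_opNorm (M : Matrix κ κ ℂ) :
    M.trace.re ≤ Fintype.card κ * ‖M‖ := by
  rw [Matrix.trace, Complex.re_sum, ← nsmul_eq_mul, ← Finset.card_univ]
  exact Finset.sum_le_card_nsmul _ _ _ fun i _ =>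
    (Complex.re_le_norm _).trans (norm_diag_le_l2_opNorm M i)

open scoped MatrixOrder in
lemma norm_two_smul_sub_one_le {F : Matrix κ κ ℂ} (h0 : F.PosSemidef) (h1 : (1 - F).PosSemidef) :
    ‖(2 : ℂ) • F - 1‖ ≤ 1 := by
  have hF : Fᴴ = F := h0.isHermitian
  have hsq : (1 - star ((2 : ℂ) • F - 1) * ((2 : ℂ) • F - 1)).PosSemidef := by
    have e : 1 - star ((2 : ℂ) • F - 1) * ((2 : ℂ) • F - 1) =
        (4 : ℂ) • (Fᴴ * (1 - F) * F + (1 - F)ᴴ * F * (1 - F)) := by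
      simp only [star_eq_conjTranspose, conjTranspose_sub, conjTranspose_smul, hF,
        conjTranspose_one, star_ofNat]
      simp only [two_smul, show (4 : ℂ) = 2 + 2 by norm_num, add_smul]
      noncomm_ring
    rw [e]
    exact ((h1.conjTranspose_mul_mul_same F).add
      (h0.conjTranspose_mul_mul_same (1 - F))).smul (by norm_num)
  have h2 : ‖star ((2 : ℂ) • F - 1) * ((2 : ℂ) • F - 1)‖ ≤ 1 :=
    (CStarAlgebra.norm_le_one_iff_of_nonneg _ (star_mul_self_nonneg _)).2
      (Matrix.le_iff.2 hsq)
  rw [CStarRing.norm_star_mul_self] at h2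
  nlinarith [norm_nonneg ((2 : ℂ) • F - 1)]

lemma trace_pow_eq_sum_eigenvalues_pow {M : Matrix κ κ ℂ} (hM : M.IsHermitian) (k : ℕ) :
    (M ^ k).trace.re = ∑ j, hM.eigenvalues j ^ k := by
  conv_lhs => rw [hM.spectral_theorem, ← map_pow, Unitary.conjStarAlgAut_apply, trace_mul_cycle,
    Unitary.coe_star_mul_self, one_mul, diagonal_pow, trace_diagonal]
  rw [Complex.re_sum]
  refine Finset.sum_congr rfl fun j _ => ?_
  simp [← Complex.ofReal_pow]

/-- The expectation of an observable in a state is at most some eigenvalue of the observable. -/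
lemma exists_re_trace_mul_le_eigenvalue {M σ : Matrix κ κ ℂ} (hM : M.IsHermitian)
    (hσ : σ.PosSemidef) (htr : σ.trace = 1) : ∃ j, (M * σ).trace.re ≤ hM.eigenvalues j := by
  set U := (hM.eigenvectorUnitary : Matrix κ κ ℂ) with hU
  have hτ : (Uᴴ * σ * U).PosSemidef := hσ.conjTranspose_mul_mul_same U
  have hτtr : (Uᴴ * σ * U).trace = 1 := by
    rw [trace_mul_cycle, ← star_eq_conjTranspose, hU, Unitary.mul_star_self_of_mem hM.eigenvectorUnitary.2,
      one_mul, htr]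
  have hsum : ∑ j, ((Uᴴ * σ * U) j j).re = 1 := by
    rw [← Complex.re_sum]; exact congrArg Complex.re hτtr
  have hexp : (M * σ).trace.re = ∑ j, hM.eigenvalues j * ((Uᴴ * σ * U) j j).re := by
    have e : (M * σ).trace =
        (diagonal (RCLike.ofReal ∘ hM.eigenvalues) * (Uᴴ * σ * U)).trace := by
      conv_lhs => rw [hM.spectral_theorem, Unitary.conjStarAlgAut_apply]
      simp only [← hU, star_eq_conjTranspose]
      rw [mul_assoc, mul_assoc, trace_mul_comm]
      simp only [mul_assoc]
    rw [e, Matrix.trace, Complex.re_sum]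
    refine Finset.sum_congr rfl fun j _ => ?_
    simp [diagonal_mul]
  have hpos : ∀ j, 0 ≤ ((Uᴴ * σ * U) j j).re := fun j =>
    (Complex.le_def.1 hτ.diag_nonneg).1
  by_contra! hlt
  have hle : ∑ j, hM.eigenvalues j * ((Uᴴ * σ * U) j j).re <
      ∑ j, (M * σ).trace.re * ((Uᴴ * σ * U) j j).re := by
    refine Finset.sum_lt_sum
      (fun j _ => mul_le_mul_of_nonneg_right (hlt j).le (hpos j)) ?_
    obtain ⟨j, -, hj⟩ := Finset.exists_ne_zero_of_sum_ne_zero (hsum ▸ one_ne_zero)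
    exact ⟨j, Finset.mem_univ j, mul_lt_mul_of_pos_right (hlt j) ((hpos j).lt_of_ne' hj)⟩
  rw [← Finset.mul_sum, hsum, mul_one, ← hexp] at hle
  exact lt_irrefl _ hle

/-- If every signed sum of contractions has expectation at least `c` in some state, then the
dimension is bounded below by comparing exponential moments. -/
lemma two_pow_mul_exp_le_of_signed_expectation_ge {ι : Type*} [Fintype ι] [DecidableEq ι]
    [Nonempty κ] (A : ι → Matrix κ κ ℂ) (hAh : ∀ i, (A i).IsHermitian) (hA : ∀ i, ‖A i‖ ≤ 1)
    (σ : (ι → Bool) → Matrix κ κ ℂ) (hσ : ∀ x, (σ x).PosSemidef) (htr : ∀ x, (σ x).trace = 1)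
    (c : ℝ) (hc : ∀ x, c ≤ ((∑ i, (bitSign (x i) : ℂ) • A i) * σ x).trace.re)
    (t : ℝ) (ht : 0 ≤ t) :
    2 ^ Fintype.card ι * Real.exp (t * c) ≤
      Fintype.card κ * (Real.exp t + Real.exp (-t)) ^ Fintype.card ι := by
  have hH : ∀ x : ι → Bool, (∑ i, (bitSign (x i) : ℂ) • A i).IsHermitian := fun x => by
    refine isSelfAdjoint_sum _ fun i _ => ?_
    exact IsSelfAdjoint.smul (Complex.conj_ofReal _) (hAh i)
  have hmom : ∀ k : ℕ, ∑ x, ∑ j, (hH x).eigenvalues j ^ k ≤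
      Fintype.card κ * ∑ x : ι → Bool, (∑ i, bitSign (x i)) ^ k := fun k => by
    have h := norm_sum_character_smul_pow_le A hA k 0
    simp only [Pi.zero_apply, pow_zero, Finset.prod_const_one, Complex.ofReal_one, one_smul,
      one_mul] at h
    simp_rw [← trace_pow_eq_sum_eigenvalues_pow, ← Complex.re_sum, ← trace_sum]
    exact (re_trace_le_card_mul_l2_opNorm _).trans
      (mul_le_mul_of_nonneg_left h (Nat.cast_nonneg _))
  have hser : ∀ r : ℝ, HasSum (fun k : ℕ => t ^ k / (k.factorial : ℝ) * r ^ k)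
      (Real.exp (t * r)) := fun r => by
    rw [Real.exp_eq_exp_ℝ]
    refine (NormedSpace.expSeries_div_hasSum_exp (t * r)).congr_fun fun k => ?_
    rw [mul_pow]; ring
  have hexp : ∑ x, ∑ j, Real.exp (t * (hH x).eigenvalues j) ≤
      Fintype.card κ * ∑ x : ι → Bool, Real.exp (t * ∑ i, bitSign (x i)) := by
    refine hasSum_le (fun k => ?_) (hasSum_sum fun x _ => hasSum_sum fun j _ =>
      hser ((hH x).eigenvalues j)) ((hasSum_sum fun x _ => hser _).mul_left _)
    simp_rw [← Finset.mul_sum]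
    rw [mul_left_comm]
    exact mul_le_mul_of_nonneg_left (hmom k) (by positivity)
  rw [sum_exp_sum_bitSign] at hexp
  refine le_trans ?_ hexp
  have hx : ∀ x : ι → Bool, Real.exp (t * c) ≤ ∑ j, Real.exp (t * (hH x).eigenvalues j) := by
    intro x
    obtain ⟨j, hj⟩ := exists_re_trace_mul_le_eigenvalue (hH x) (hσ x) (htr x)
    refine le_trans (Real.exp_le_exp.2 (mul_le_mul_of_nonneg_left ((hc x).trans hj) ht)) ?_
    exact Finset.single_le_sum (f := fun j => Real.exp (t * (hH x).eigenvalues j))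
      (fun j _ => (Real.exp_pos _).le) (Finset.mem_univ j)
  simpa using Finset.card_nsmul_le_sum Finset.univ _ _ fun x _ => hx x

end Matrices

lemma binEnt_eq_binEntropy_div (e : ℝ) : binEnt e = Real.binEntropy e / Real.log 2 := by
  simp only [binEnt, Real.binEntropy, Real.logb, Real.log_inv]
  ring

lemma QOneWay.mono {A B : Type} {g : A → B → Bool} {m : ℕ} {ε δ : ℝ}
    {ρ : A → Matrix (Fin (2 ^ m)) (Fin (2 ^ m)) ℂ} {E : B → Matrix (Fin (2 ^ m)) (Fin (2 ^ m)) ℂ}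
    (h : QOneWay g m ε ρ E) (hεδ : ε ≤ δ) : QOneWay g m δ ρ E := by
  refine ⟨h.1, h.2.1, fun a b => ?_⟩
  have := h.2.2 a b
  split_ifs at this ⊢ <;> linarith

lemma DISJ_single (n : ℕ) (x : Fin n → Bool) (i : Fin n) :
    DISJ n x (Pi.single i true) = !x i := by
  have : (∀ j, ¬(x j = true ∧ (Pi.single i true : Fin n → Bool) j = true)) ↔ x i = false := by
    constructor
    · intro h
      simpa using h i
    · rintro h j ⟨h1, h2⟩
      by_cases hj : j = i
      · simp [hj, h] at h1
      · simp [Pi.single_eq_of_ne hj] at h2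
  rw [Bool.eq_iff_iff, DISJ, decide_eq_true_iff, this, Bool.not_eq_true']

lemma QOneWay.signed_expectation_ge {n m : ℕ} {ε : ℝ}
    {ρ E : (Fin n → Bool) → Matrix (Fin (2 ^ m)) (Fin (2 ^ m)) ℂ}
    (h : QOneWay (DISJ n) m ε ρ E) (x : Fin n → Bool) :
    n * (1 - 2 * ε) ≤ ((∑ i, (bitSign (x i) : ℂ) •
      ((2 : ℂ) • E (Pi.single i true) - 1)) * ρ x).trace.re := by
  rw [Finset.sum_mul, Matrix.trace_sum, Complex.re_sum]
  have hi : ∀ i : Fin n, 1 - 2 * ε ≤ (((bitSign (x i) : ℂ) •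
      ((2 : ℂ) • E (Pi.single i true) - 1)) * ρ x).trace.re := fun i => by
    have hg := h.2.2 x (Pi.single i true)
    rw [DISJ_single] at hg
    have e : (((bitSign (x i) : ℂ) • ((2 : ℂ) • E (Pi.single i true) - 1)) * ρ x).trace.re =
        bitSign (x i) * (2 * accProb (E (Pi.single i true)) (ρ x) - 1) := by
      simp [accProb, sub_mul, Matrix.trace_sub, (h.1 x).2]
    rw [e]
    cases hx : x i <;> simp [hx, bitSign] at hg ⊢ <;> linarith
  simpa using Finset.card_nsmul_le_sum Finset.univ _ _ fun i _ => hi i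

open scoped Matrix.Norms.L2Operator in
lemma QOneWay.two_pow_mul_exp_le {n m : ℕ} {ε : ℝ}
    {ρ E : (Fin n → Bool) → Matrix (Fin (2 ^ m)) (Fin (2 ^ m)) ℂ}
    (h : QOneWay (DISJ n) m ε ρ E) (t : ℝ) (ht : 0 ≤ t) :
    2 ^ n * Real.exp (t * (n * (1 - 2 * ε))) ≤ 2 ^ m * (Real.exp t + Real.exp (-t)) ^ n := by
  have := two_pow_mul_exp_le_of_signed_expectation_ge
    (fun i => (2 : ℂ) • E (Pi.single i true) - 1)
    (fun i => (IsSelfAdjoint.smul (Complex.conj_ofReal 2) (h.2.1 _).1.isHermitian).sub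
      (IsSelfAdjoint.one _))
    (fun i => norm_two_smul_sub_one_le (h.2.1 _).1 (h.2.1 _).2) ρ (fun x => (h.1 x).1)
    (fun x => (h.1 x).2) _ h.signed_expectation_ge t ht
  simpa using this

lemma QOneWay.one_sub_binEnt_mul_le_of_pos {n m : ℕ} {ε : ℝ} (hε0 : 0 < ε) (hε1 : ε < 1 / 2)
    {ρ E : (Fin n → Bool) → Matrix (Fin (2 ^ m)) (Fin (2 ^ m)) ℂ}
    (h : QOneWay (DISJ n) m ε ρ E) : (1 - binEnt ε) * n ≤ m := by
  have h1 : 0 < 1 - ε := by linarith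
  set t : ℝ := (Real.log (1 - ε) - Real.log ε) / 2 with ht
  have ht0 : 0 ≤ t := by
    have := Real.log_le_log hε0 (show ε ≤ 1 - ε by linarith)
    linarith
  have hsum : Real.exp t + Real.exp (-t) = Real.exp (t - Real.log (1 - ε)) := by
    have e : Real.exp (-t) = Real.exp (t - Real.log (1 - ε)) * ε := by
      nth_rw 2 [← Real.exp_log hε0]
      rw [← Real.exp_add]
      congr 1; rw [ht]; ring
    have e' : Real.exp t = Real.exp (t - Real.log (1 - ε)) * (1 - ε) := by
      nth_rw 2 [← Real.exp_log h1]
      rw [← Real.exp_add]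
      congr 1; ring
    rw [e, e', ← mul_add]; ring
  have key := h.two_pow_mul_exp_le t ht0
  rw [hsum, ← Real.exp_nat_mul] at key
  have hlog := Real.log_le_log (by positivity) key
  rw [Real.log_mul (by positivity) (Real.exp_pos _).ne',
    Real.log_mul (by positivity) (Real.exp_pos _).ne', Real.log_exp, Real.log_exp,
    Real.log_pow, Real.log_pow] at hlog
  have hl2 : 0 < Real.log 2 := Real.log_pos one_lt_two
  rw [binEnt_eq_binEntropy_div, one_sub_div hl2.ne', div_mul_eq_mul_div, div_le_iff₀ hl2]
  simp only [Real.binEntropy, Real.log_inv]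
  rw [ht] at hlog
  linarith

/-- Every quantum one-way protocol of cost `m` computing `DISJ_n` with error
`ε < 1/2` satisfies `m ≥ (1 − H(ε))·n`. -/
theorem stmt13 (n : ℕ) (hn : 1 ≤ n) (ε : ℝ) (hε0 : 0 ≤ ε) (hε1 : ε < 1/2)
    (m : ℕ) (ρ : (Fin n → Bool) → Matrix (Fin (2 ^ m)) (Fin (2 ^ m)) ℂ)
    (E : (Fin n → Bool) → Matrix (Fin (2 ^ m)) (Fin (2 ^ m)) ℂ)
    (h : QOneWay (DISJ n) m ε ρ E) :
    (1 - binEnt ε) * n ≤ m := by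
  have hcont : Continuous fun δ => (1 - binEnt δ) * (n : ℝ) := by
    simp_rw [binEnt_eq_binEntropy_div]
    fun_prop
  refine le_of_tendsto ((hcont.tendsto ε).mono_left (nhdsWithin_le_nhds (s := Set.Ioi ε))) ?_
  filter_upwards [Ioo_mem_nhdsGT hε1] with δ hδ
  exact (h.mono hδ.1.le).one_sub_binEnt_mul_le_of_pos (hε0.trans_lt hδ.1) hδ.2
end

section
/- Let f : {0,1}^n → {0,1}, let y_1,…,y_k be a partition of its input variables into nonempty blocks, and let s be a nonnegative integer. Every nondeterministic Boolean formula with s nondeterministic bits computing f satisfies ∑_{i=1}^k N_s(f_i) ≤ 4·L + 2k, where L is the number of its leaves labeled by the input variables x_1,…,x_n. In particular its size is at least (1/4)·∑_{i=1}^k N_s(f_i) − k/2. -/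
open scoped ENNReal

/-- A Boolean formula over variables `V`. -/
inductive BFormula (V : Type) : Type
  | var : V → BFormula V
  | const : Bool → BFormula V
  | node : (Bool → Bool → Bool) → BFormula V → BFormula V → BFormula V

namespace BFormula

/-- Evaluation of a formula on an assignment. -/
def eval {V : Type} (x : V → Bool) : BFormula V → Bool
  | var v => x v
  | const b => b
  | node g l r => g (eval x l) (eval x r)

/-- Number of leaves labeled by a variable satisfying `P`. -/
def sizeP {V : Type} (P : V → Bool) : BFormula V → ℕ
  | var v => if P v then 1 else 0
  | const _ => 0
  | node _ l r => sizeP P l + sizeP P r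

/-- Number of leaves labeled by variables. -/
def size {V : Type} (F : BFormula V) : ℕ := sizeP (fun _ => true) F

end BFormula

/-- Expected size of a strong probabilistic formula (distribution on formulas). -/
noncomputable def pmfSize {V : Type} (p : PMF (BFormula V)) : ℝ≥0∞ :=
  ∑' F, p F * (F.size : ℝ≥0∞)

/-- A strong probabilistic formula computes `f` with bounded error (2/3). -/
def ComputesBdd {V : Type} (p : PMF (BFormula V)) (f : (V → Bool) → Bool) : Prop :=
  ∀ x : V → Bool, 2/3 ≤ ∑' F, (if F.eval x = f x then p F else 0)

/-- Alice's inputs in the `i`-th communication game: variables outside block `i`. -/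
def AliceT {n k : ℕ} (y : Fin n → Fin k) (i : Fin k) : Type := {j : Fin n // y j ≠ i} → Bool
/-- Bob's inputs in the `i`-th communication game: variables in block `i`. -/
def BobT {n k : ℕ} (y : Fin n → Fin k) (i : Fin k) : Type := {j : Fin n // y j = i} → Bool

/-- Combining Alice's and Bob's inputs to a full input. -/
def combine {n k : ℕ} (y : Fin n → Fin k) (i : Fin k)
    (a : AliceT y i) (b : BobT y i) : Fin n → Bool :=
  fun j => if h : y j = i then b ⟨j, h⟩ else a ⟨j, h⟩

/-- The `i`-th communication game induced by `f` and the partition `y`. -/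
def game {n k : ℕ} (f : (Fin n → Bool) → Bool) (y : Fin n → Fin k) (i : Fin k) :
    AliceT y i → BobT y i → Bool :=
  fun a b => f (combine y i a b)

/-- Deterministic one-way communication complexity. -/
noncomputable def Dcc {A B : Type} (g : A → B → Bool) : ℕ :=
  sInf {c : ℕ | ∃ M : A → Fin (2^c), ∃ o : Fin (2^c) → B → Bool, ∀ a b, o (M a) b = g a b}

/-- `S` is shattered by the rows of `g`. -/
def Shatters {A B : Type} (g : A → B → Bool) (S : Finset B) : Prop :=
  ∀ R ⊆ S, ∃ a : A, ∀ b ∈ S, (g a b = true ↔ b ∈ R)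

/-- VC-dimension of the two-party problem `g`. -/
noncomputable def VCdim {A B : Type} (g : A → B → Bool) : ℕ :=
  sSup {d : ℕ | ∃ S : Finset B, Shatters g S ∧ S.card = d}
/-- Nondeterministic one-way communication complexity with `s` nondeterministic
bits: the minimal cost `c` of a protocol in which Alice guesses `s` bits and sends
a message of `c` bits, and an input is accepted iff some guess makes Bob accept. -/
noncomputable def Ncc {A B : Type} (g : A → B → Bool) (s : ℕ) : ℕ :=
  sInf {c : ℕ | ∃ M : A → (Fin s → Bool) → Fin (2 ^ c), ∃ o : Fin (2 ^ c) → B → Bool,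
    ∀ a b, g a b = true ↔ ∃ w : Fin s → Bool, o (M a w) b = true}

namespace BFormula

theorem eval_congr {V : Type} {x x' : V → Bool} {P : V → Bool}
    (h : ∀ v, P v = false → x v = x' v) :
    ∀ F : BFormula V, F.sizeP P = 0 → F.eval x = F.eval x'
  | var v, hF => by
    apply h
    simpa [sizeP] using hF
  | const _, _ => rfl
  | node g l r, hF => by
    simp only [sizeP, Nat.add_eq_zero_iff] at hF
    simp only [eval, eval_congr h l hF.1, eval_congr h r hF.2]

/-- If the variables satisfying `P` depend only on `b` and the others only on `a`, then up to
post-composition with a unary function, a formula with `L > 0` leaves in `P` induces at most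
`2 ^ (4 * L - 2)` functions of `b`. -/
theorem exists_finset_subfunctions {V A B : Type} (P : V → Bool) (x : A → B → V → Bool)
    (hA : ∀ v, P v = false → ∀ a b b', x a b v = x a b' v)
    (hB : ∀ v, P v = true → ∀ a a' b, x a b v = x a' b v) :
    ∀ F : BFormula V, 0 < F.sizeP P →
      ∃ S : Finset (B → Bool), S.card ≤ 2 ^ (4 * F.sizeP P - 2) ∧
        ∀ a (h : Bool → Bool), (fun b => h (F.eval (x a b))) ∈ S := by
  classical
  intro F
  induction F with
  | var v =>
    intro hF
    have hv : P v = true := by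
      by_contra hv
      simp [sizeP, hv] at hF
    rcases isEmpty_or_nonempty A with _ | ⟨⟨a₀⟩⟩
    · exact ⟨∅, by simp, fun a => isEmptyElim a⟩
    · refine ⟨Finset.univ.image fun (h : Bool → Bool) b => h (x a₀ b v), ?_, fun a h => ?_⟩
      · refine Finset.card_image_le.trans ?_
        simp [sizeP, hv]
      · refine Finset.mem_image.2 ⟨h, Finset.mem_univ _, ?_⟩
        funext b
        simp only [eval, hB v hv a a₀ b]
  | const c => intro hF; simp [sizeP] at hF
  | node g l r ihl ihr =>
    intro hF
    rcases Nat.eq_zero_or_pos (l.sizeP P) with hl | hl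
    · have hr : 0 < r.sizeP P := by simpa [sizeP, hl] using hF
      obtain ⟨S, hS, hmem⟩ := ihr hr
      refine ⟨S, by simpa [sizeP, hl] using hS, fun a h => ?_⟩
      rcases isEmpty_or_nonempty B with _ | ⟨⟨b₀⟩⟩
      · convert hmem a h using 1
      · convert hmem a (fun t => h (g (l.eval (x a b₀)) t)) using 2 with b
        simp only [eval, eval_congr (fun v hv => hA v hv a b b₀) l hl]
    rcases Nat.eq_zero_or_pos (r.sizeP P) with hr | hr
    · obtain ⟨S, hS, hmem⟩ := ihl hl
      refine ⟨S, by simpa [sizeP, hr] using hS, fun a h => ?_⟩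
      rcases isEmpty_or_nonempty B with _ | ⟨⟨b₀⟩⟩
      · convert hmem a h using 1
      · convert hmem a (fun t => h (g t (r.eval (x a b₀)))) using 2 with b
        simp only [eval, eval_congr (fun v hv => hA v hv a b b₀) r hr]
    obtain ⟨S, hS, hSmem⟩ := ihl hl
    obtain ⟨T, hT, hTmem⟩ := ihr hr
    refine ⟨((Finset.univ : Finset (Bool → Bool)) ×ˢ S ×ˢ T).image
      fun p b => p.1 (g (p.2.1 b) (p.2.2 b)), ?_, fun a h => ?_⟩
    · refine Finset.card_image_le.trans ?_
      rw [Finset.card_product, Finset.card_product]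
      calc (Finset.univ : Finset (Bool → Bool)).card * (S.card * T.card)
          ≤ 2 ^ 2 * (2 ^ (4 * l.sizeP P - 2) * 2 ^ (4 * r.sizeP P - 2)) :=
            Nat.mul_le_mul (by simp) (Nat.mul_le_mul hS hT)
        _ = 2 ^ (4 * (node g l r).sizeP P - 2) := by
            rw [← pow_add, ← pow_add]
            congr 1
            simp only [sizeP]
            omega
    · exact Finset.mem_image.2 ⟨(h, _, _), Finset.mem_product.2 ⟨Finset.mem_univ _,
        Finset.mem_product.2 ⟨hSmem a id, hTmem a id⟩⟩, rfl⟩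

theorem sum_sizeP {V ι : Type} [Fintype ι] (P : ι → V → Bool) (Q : V → Bool)
    (h : ∀ v, ∑ i, (if P i v then 1 else 0) = if Q v then 1 else 0) :
    ∀ F : BFormula V, ∑ i, F.sizeP (P i) = F.sizeP Q
  | var v => h v
  | const _ => by simp [sizeP]
  | node _ l r => by simp only [sizeP, Finset.sum_add_distrib, sum_sizeP P Q h l, sum_sizeP P Q h r]

end BFormula

/-- A nondeterministic protocol in which Alice sends Bob the name of a function from a finite
set. -/
theorem Ncc_le_of_finset {A B : Type} {s c : ℕ} (g : A → B → Bool)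
    (φ : A → (Fin s → Bool) → B → Bool) (hg : ∀ a b, g a b = true ↔ ∃ w, φ a w b = true)
    (S : Finset (B → Bool)) (hS : S.card ≤ 2 ^ c) (hφ : ∀ a w, φ a w ∈ S) : Ncc g s ≤ c := by
  obtain ⟨e⟩ : Nonempty (S ↪ Fin (2 ^ c)) :=
    Function.Embedding.nonempty_of_card_le (by simpa using hS)
  refine Nat.sInf_le ⟨fun a w => e ⟨φ a w, hφ a w⟩,
    fun m => Function.extend e Subtype.val (fun _ _ => false) m, fun a b => ?_⟩
  simp only [e.injective.extend_apply]
  exact hg a b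

theorem Ncc_game_le {n k s : ℕ} (f : (Fin n → Bool) → Bool) (y : Fin n → Fin k)
    (G : BFormula (Fin n ⊕ Fin s))
    (hG : ∀ x : Fin n → Bool,
      f x = true ↔ ∃ w : Fin s → Bool, G.eval (Sum.elim x w) = true) (i : Fin k) :
    Ncc (game f y i) s ≤
      4 * G.sizeP (Sum.elim (fun j => decide (y j = i)) fun _ => false) + 2 := by
  classical
  set P : Fin n ⊕ Fin s → Bool := Sum.elim (fun j => decide (y j = i)) fun _ => false with hP
  let x : AliceT y i × (Fin s → Bool) → BobT y i → Fin n ⊕ Fin s → Bool :=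
    fun p b => Sum.elim (combine y i p.1 b) p.2
  have hA : ∀ v, P v = false → ∀ p b b', x p b v = x p b' v := by
    rintro (j | j) hv p b b'
    · have hj : y j ≠ i := by simpa [hP] using hv
      simp [x, combine, hj]
    · rfl
  have hB : ∀ v, P v = true → ∀ p p' b, x p b v = x p' b v := by
    rintro (j | j) hv p p' b
    · have hj : y j = i := by simpa [hP] using hv
      simp [x, combine, hj]
    · simp [hP] at hv
  have key : ∃ S : Finset (BobT y i → Bool), S.card ≤ 2 ^ (4 * G.sizeP P + 2) ∧
      ∀ p, (fun b => G.eval (x p b)) ∈ S := by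
    rcases Nat.eq_zero_or_pos (G.sizeP P) with h0 | h0
    · refine ⟨Finset.univ.image fun c _ => c, Finset.card_image_le.trans (by simp [h0]),
        fun p => Finset.mem_image.2 ⟨G.eval (x p fun _ => false), Finset.mem_univ _, ?_⟩⟩
      funext b
      exact BFormula.eval_congr (fun v hv => hA v hv p _ b) G h0
    · obtain ⟨S, hS, hmem⟩ := BFormula.exists_finset_subfunctions P x hA hB G h0
      exact ⟨S, hS.trans (Nat.pow_le_pow_right two_pos (by omega)), fun p => hmem p id⟩
  obtain ⟨S, hS, hmem⟩ := key
  exact Ncc_le_of_finset _ (fun a w b => G.eval (x (a, w) b)) (fun a b => hG _) S hS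
    fun a w => hmem (a, w)

/-- The `s`-nondeterministic Ne\v ciporuk bound: every nondeterministic Boolean
formula with `s` nondeterministic bits computing `f` satisfies
`∑ᵢ N_s(f_i) ≤ 4·L + 2k`, where `L` is the number of its leaves labeled by input
variables. -/
theorem stmt15 {n k s : ℕ} (f : (Fin n → Bool) → Bool) (y : Fin n → Fin k)
    (hy : Function.Surjective y) (G : BFormula (Fin n ⊕ Fin s))
    (hG : ∀ x : Fin n → Bool,
      f x = true ↔ ∃ w : Fin s → Bool, G.eval (Sum.elim x w) = true) :
    ∑ i : Fin k, Ncc (game f y i) s ≤ 4 * G.sizeP (fun v => v.isLeft) + 2 * k := by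
  calc ∑ i : Fin k, Ncc (game f y i) s
      ≤ ∑ i : Fin k,
          (4 * G.sizeP (Sum.elim (fun j => decide (y j = i)) fun _ => false) + 2) :=
        Finset.sum_le_sum fun i _ => Ncc_game_le f y G hG i
    _ = 4 * G.sizeP (fun v => v.isLeft) + 2 * k := by
        rw [Finset.sum_add_distrib, ← Finset.mul_sum,
          BFormula.sum_sizeP _ (fun v => v.isLeft) (by rintro (j | j) <;> simp) G]
        simp [mul_comm]
end

section
/- Let n ≥ 1 and let A and B be n×n matrices over the two-element field GF(2). If A·B = 0 then for all vectors r₁, r₂ ∈ GF(2)ⁿ one has r₁ᵀ·(A·B)·r₂ = 0. If A·B ≠ 0, then for independent uniformly random vectors r₁, r₂ ∈ GF(2)ⁿ, the probability that r₁ᵀ·(A·B)·r₂ = 1 is at least 1/4; equivalently, at least 4ⁿ/4 of the 4ⁿ pairs (r₁,r₂) ∈ GF(2)ⁿ × GF(2)ⁿ satisfy r₁ᵀ·(A·B)·r₂ = 1. -/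
open scoped Matrix

open scoped Pointwise in
/-- A nonzero bilinear form over `GF(2)` takes the value `1` on at least a quarter of all pairs. -/
theorem four_pow_card_le_four_mul_card_dotProduct_mulVec_eq_one {ι : Type*} [Fintype ι]
    [DecidableEq ι] {M : Matrix ι ι (ZMod 2)} (hM : M ≠ 0) :
    4 ^ Fintype.card ι ≤ 4 * (Finset.univ.filter
      (fun p : (ι → ZMod 2) × (ι → ZMod 2) => p.1 ⬝ᵥ (M *ᵥ p.2) = 1)).card := by
  have two_cases : ∀ a : ZMod 2, a = 0 ∨ a = 1 := by decide
  obtain ⟨i, j, hij⟩ : ∃ i j, M i j = 1 := by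
    by_contra! h
    exact hM (Matrix.ext fun i j => (two_cases (M i j)).resolve_right (h i j))
  set S := Finset.univ.filter
    (fun p : (ι → ZMod 2) × (ι → ZMod 2) => p.1 ⬝ᵥ (M *ᵥ p.2) = 1) with hS
  let T : Finset ((ι → ZMod 2) × (ι → ZMod 2)) := {0, Pi.single i 1} ×ˢ {0, Pi.single j 1}
  have hT : T.card ≤ 4 := by
    rw [Finset.card_product]
    exact Nat.mul_le_mul Finset.card_le_two Finset.card_le_two
  have hcover : (Finset.univ : Finset ((ι → ZMod 2) × (ι → ZMod 2))) ⊆ S - T := by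
    intro p _
    suffices ∃ t ∈ T, p + t ∈ S by
      obtain ⟨t, ht, hpt⟩ := this
      exact Finset.mem_sub.2 ⟨p + t, hpt, t, ht, add_sub_cancel_right p t⟩
    by_contra! h
    have vanish : ∀ t ∈ T, (p + t).1 ⬝ᵥ (M *ᵥ (p + t).2) = 0 := fun t ht =>
      (two_cases _).resolve_right fun h1 => h t ht (by simpa [hS] using h1)
    have h00 := vanish (0, 0) (by simp [T])
    have h10 := vanish (Pi.single i 1, 0) (by simp [T])
    have h01 := vanish (0, Pi.single j 1) (by simp [T])
    have h11 := vanish (Pi.single i 1, Pi.single j 1) (by simp [T])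
    simp only [Prod.fst_add, Prod.snd_add, add_zero, Matrix.mulVec_add, dotProduct_add,
      add_dotProduct] at h00 h10 h01 h11
    have hentry : Pi.single i 1 ⬝ᵥ (M *ᵥ Pi.single j 1) = (1 : ZMod 2) := by
      simp [hij]
    rw [hentry] at h11
    exact one_ne_zero (α := ZMod 2) (by linear_combination h11 - h10 - h01 + h00)
  calc 4 ^ Fintype.card ι
      = (Finset.univ : Finset ((ι → ZMod 2) × (ι → ZMod 2))).card := by
        simp [← mul_pow]
    _ ≤ (S - T).card := Finset.card_le_card hcover
    _ ≤ S.card * T.card := Finset.card_sub_le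
    _ ≤ 4 * S.card := by
        rw [mul_comm]
        exact Nat.mul_le_mul_right _ hT

/-- If `A·B = 0` then `r₁ᵀ(A·B)r₂ = 0` for all `r₁,r₂ ∈ GF(2)ⁿ`; if `A·B ≠ 0`
then at least a quarter of all `4ⁿ` pairs `(r₁,r₂)` satisfy `r₁ᵀ(A·B)r₂ = 1`. -/
theorem stmt17 (n : ℕ) (hn : 1 ≤ n) (A B : Matrix (Fin n) (Fin n) (ZMod 2)) :
    (A * B = 0 → ∀ r₁ r₂ : Fin n → ZMod 2, r₁ ⬝ᵥ ((A * B) *ᵥ r₂) = 0) ∧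
    (A * B ≠ 0 →
      4 ^ n ≤ 4 * (Finset.univ.filter
        (fun p : (Fin n → ZMod 2) × (Fin n → ZMod 2) =>
          p.1 ⬝ᵥ ((A * B) *ᵥ p.2) = 1)).card) := by
  refine ⟨fun h r₁ r₂ => by simp [h], fun h => ?_⟩
  simpa only [Fintype.card_fin] using
    four_pow_card_le_four_mul_card_dotProduct_mulVec_eq_one h
end

section
/- Let s ≥ 2 be an even integer and let m ≥ s. Then there exists a family 𝓕 of s-element subsets of {1,…,m} such that any two distinct members of 𝓕 have fewer than s/2 common elements and |𝓕| ≥ binom(m,s) / (binom(s,s/2)·binom(m,s/2)). -/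
/-- The `2 * h`-element sets meeting `A` in at least `h` elements all arise as unions of an
`h`-element subset of `A` and an `h`-element set. -/
theorem Finset.mem_image_union_of_le_card_inter {α : Type*} [Fintype α] [DecidableEq α]
    {h : ℕ} {A B : Finset α} (hB : B.card = h + h) (hAB : h ≤ (A ∩ B).card) :
    B ∈ (A.powersetCard h ×ˢ (Finset.univ : Finset α).powersetCard h).image
      (fun p => p.1 ∪ p.2) := by
  obtain ⟨T, hT, hTc⟩ := Finset.exists_subset_card_eq hAB
  have hTB : T ⊆ B := hT.trans Finset.inter_subset_right
  refine Finset.mem_image.2 ⟨(T, B \ T), ?_, Finset.union_sdiff_of_subset hTB⟩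
  simp only [Finset.mem_product, Finset.mem_powersetCard]
  refine ⟨⟨hT.trans Finset.inter_subset_left, hTc⟩, Finset.subset_univ _, ?_⟩
  rw [Finset.card_sdiff_of_subset hTB]
  omega

/-- There is a family of `s`-element sets with pairwise intersections smaller than `h` that is
maximal: every `s`-element set meets some member in at least `h` elements. -/
theorem Finset.exists_maximal_family_card_inter_lt {α : Type*} [Fintype α] [DecidableEq α]
    {s h : ℕ} (hs : h ≤ s) :
    ∃ 𝓕 : Finset (Finset α),
      (∀ A ∈ 𝓕, A.card = s) ∧
      (∀ A ∈ 𝓕, ∀ B ∈ 𝓕, A ≠ B → (A ∩ B).card < h) ∧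
      ∀ B : Finset α, B.card = s → ∃ A ∈ 𝓕, h ≤ (A ∩ B).card := by
  classical
  let P : Finset (Finset α) → Prop := fun 𝓕 =>
    (∀ A ∈ 𝓕, A.card = s) ∧ ∀ A ∈ 𝓕, ∀ B ∈ 𝓕, A ≠ B → (A ∩ B).card < h
  obtain ⟨𝓕, hP, hmax⟩ := (Set.toFinite {𝓕 | P 𝓕}).exists_maximal ⟨∅, by simp [P]⟩
  refine ⟨𝓕, hP.1, hP.2, fun B hB => ?_⟩
  by_contra! hlt
  have hins : P (insert B 𝓕) := by
    refine ⟨fun A hA => ?_, fun A hA C hC hne => ?_⟩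
    · rcases Finset.mem_insert.1 hA with rfl | hA
      exacts [hB, hP.1 A hA]
    · rcases Finset.mem_insert.1 hA with rfl | hA' <;>
        rcases Finset.mem_insert.1 hC with rfl | hC'
      · exact absurd rfl hne
      · rw [Finset.inter_comm]
        exact hlt C hC'
      · exact hlt A hA'
      · exact hP.2 A hA' C hC' hne
  have hmem : B ∈ 𝓕 := hmax hins (Finset.subset_insert B 𝓕) (Finset.mem_insert_self B 𝓕)
  have := hlt B hmem
  rw [Finset.inter_self] at this
  omega

/-- For even `s ≥ 2` and `m ≥ s` there is a family of `s`-element subsets of an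
`m`-element set, any two distinct members intersecting in fewer than `s/2`
elements, of cardinality at least `binom(m,s)/(binom(s,s/2)·binom(m,s/2))`. -/
theorem stmt19 (s m : ℕ) (hs2 : 2 ≤ s) (hse : Even s) (hm : s ≤ m) :
    ∃ 𝓕 : Finset (Finset (Fin m)),
      (∀ A ∈ 𝓕, A.card = s) ∧
      (∀ A ∈ 𝓕, ∀ B ∈ 𝓕, A ≠ B → (A ∩ B).card < s / 2) ∧
      (m.choose s : ℝ) / (s.choose (s / 2) * m.choose (s / 2)) ≤ 𝓕.card := by
  obtain ⟨𝓕, hcard, hinter, hcover⟩ :=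
    Finset.exists_maximal_family_card_inter_lt (α := Fin m) (Nat.div_le_self s 2)
  refine ⟨𝓕, hcard, hinter, ?_⟩
  have hhalf : s = s / 2 + s / 2 := by
    obtain ⟨k, rfl⟩ := hse
    omega
  have hsub : (Finset.univ : Finset (Fin m)).powersetCard s ⊆ 𝓕.biUnion fun A =>
      (A.powersetCard (s / 2) ×ˢ (Finset.univ : Finset (Fin m)).powersetCard (s / 2)).image
        (fun p => p.1 ∪ p.2) := by
    intro B hB
    have hBs := (Finset.mem_powersetCard.1 hB).2
    obtain ⟨A, hA, hAB⟩ := hcover B hBs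
    exact Finset.mem_biUnion.2
      ⟨A, hA, Finset.mem_image_union_of_le_card_inter (hBs.trans hhalf) hAB⟩
  have hle : m.choose s ≤ 𝓕.card * (s.choose (s / 2) * m.choose (s / 2)) := by
    calc m.choose s = ((Finset.univ : Finset (Fin m)).powersetCard s).card := by
          rw [Finset.card_powersetCard, Finset.card_univ, Fintype.card_fin]
      _ ≤ _ := Finset.card_le_card hsub
      _ ≤ _ := Finset.card_biUnion_le_card_mul _ _ _ fun A hA => by
        refine Finset.card_image_le.trans ?_
        rw [Finset.card_product, Finset.card_powersetCard, Finset.card_powersetCard, hcard A hA,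
          Finset.card_univ, Fintype.card_fin]
  clear hhalf
  refine div_le_of_le_mul₀ (by positivity) (by positivity) ?_
  exact_mod_cast hle
end
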